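/- Fix an integer K ≥ 1 and a universe U equipped with a linear order ≤. The LRU-K paging algorithm over U is stable: for every sequence τ, every X ⊆ U, every z ∈ X, and all cache sizes a > b, if Out(LRUK_b, τ[X], z) ∩ LRUK_a(τz) ≠ ∅ then LRUK_b(τ[X]z) ⊆ LRUK_a(τz). -/

import Mathlib

open scoped Classical

namespace SetAssoc

variable {U : Type*} [LinearOrder U]

/-- `τ[X]`: the subsequence of `τ` consisting of the requests to items of `X`. -/
noncomputable def restrict (τ : List U) (X : Set U) : List U :=
  τ.filter (fun a => decide (a ∈ X))

/-- The set of items evicted by `A_k` in response to a request `z` after serving `τ`. -/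
def Out (A : ℕ → List U → Finset U) (k : ℕ) (τ : List U) (z : U) : Finset U :=
  A k τ \ A k (τ ++ [z])

/-- `phiRev x K ρ` is `Φ` computed on the *reversed* request sequence `ρ` (most recent
request first): the number of requests issued after the `K`-th most recent access to
`x`, or `⊤` if `x` is requested fewer than `K` times. -/
def phiRev (x : U) : ℕ → List U → ℕ∞
  | _, [] => ⊤
  | K, y :: rest =>
    if y = x then (if K ≤ 1 then 0 else phiRev x (K - 1) rest + 1)
    else phiRev x K rest + 1

/-- `Φ(σ, x)`: the number of requests issued in `σ` after the `K`-th most recent access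
to `x` (`⊤` if `x` is requested fewer than `K` times in `σ`). -/
def phi (K : ℕ) (σ : List U) (x : U) : ℕ∞ :=
  phiRev x K σ.reverse

/-- The LRU-K cache computed on the *reversed* request sequence (most recent request
first). On a miss with a full (nonempty) cache, the cached item `y` maximizing
`Φ(τz, ·)`, ties broken by taking the `≤`-largest such item, is evicted. -/
def LRUKrev (K k : ℕ) : List U → Finset U
  | [] => ∅
  | z :: τ =>
    let C := LRUKrev K k τ
    if z ∈ C then C
    else if C.card < k then insert z C
    else if hC : C.Nonempty then
      insert z C \ {(ofLex (C.sup' hC fun y => toLex (phiRev y K (z :: τ), y))).2}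
    else C

/-- The LRU-K paging algorithm: `LRUK K k σ` is the cache of size `k` after serving
the request sequence `σ`. -/
def LRUK (K k : ℕ) (σ : List U) : Finset U :=
  LRUKrev K k σ.reverse

/-- The eviction key of `x` after the reversed request sequence `ρ`: larger means evicted
earlier. -/
def evictKey (K : ℕ) (ρ : List U) (x : U) : ℕ∞ ×ₗ U :=
  toLex (phiRev x K ρ, x)

theorem evictKey_lt_iff {K : ℕ} {ρ : List U} {x y : U} :
    evictKey K ρ x < evictKey K ρ y ↔
      phiRev x K ρ < phiRev y K ρ ∨ (¬ phiRev y K ρ < phiRev x K ρ ∧ x < y) := by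
  rw [evictKey, evictKey, Prod.Lex.toLex_lt_toLex]
  grind

theorem evictKey_injective (K : ℕ) (ρ : List U) : Function.Injective (evictKey K ρ) := by
  intro x y h
  exact congrArg (fun p => (ofLex p).2) h

theorem enat_add_one_lt_add_one_iff {m n : ℕ∞} : m + 1 < n + 1 ↔ m < n :=
  ENat.add_lt_add_iff_right ENat.one_ne_top

theorem phiRev_cons_of_ne {K : ℕ} {ρ : List U} {x z : U} (h : z ≠ x) :
    phiRev x K (z :: ρ) = phiRev x K ρ + 1 := by
  rw [phiRev, if_neg h]

theorem phiRev_mono (x : U) (ρ : List U) : Monotone fun K => phiRev x K ρ := by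
  induction ρ with
  | nil => intro i j _; simp [phiRev]
  | cons h ρ ih =>
    intro i j hij
    by_cases hx : h = x
    · by_cases hi : i ≤ 1
      · simp [phiRev, hx, hi]
      · have hj : ¬ j ≤ 1 := by omega
        simpa [phiRev, hx, hi, hj] using
          add_le_add_left (ih (show i - 1 ≤ j - 1 by omega)) 1
    · simpa [phiRev, hx] using add_le_add_left (ih hij) 1

theorem phiRev_cons_le (K : ℕ) (ρ : List U) (x z : U) :
    phiRev x K (z :: ρ) ≤ phiRev x K ρ + 1 := by
  by_cases h : z = x
  · by_cases hK : K ≤ 1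
    · simp [phiRev, h, hK]
    · simpa [phiRev, h, hK] using
        add_le_add_left (phiRev_mono x ρ (show K - 1 ≤ K by omega)) 1
  · exact (phiRev_cons_of_ne h).le

/-- A request to `z` never improves the rank of an item `y ≠ z` relative to any item. -/
theorem evictKey_cons_lt {K : ℕ} {ρ : List U} {x y z : U} (hy : y ≠ z)
    (h : evictKey K ρ x < evictKey K ρ y) :
    evictKey K (z :: ρ) x < evictKey K (z :: ρ) y := by
  have hx := phiRev_cons_le K ρ x z
  rw [evictKey_lt_iff] at h ⊢
  rw [phiRev_cons_of_ne hy.symm]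
  rcases h with h | ⟨h, hxy⟩
  · exact Or.inl (hx.trans_lt (enat_add_one_lt_add_one_iff.2 h))
  · refine Or.inr ⟨?_, hxy⟩
    rw [not_lt] at h ⊢
    exact hx.trans (add_le_add_left h 1)

theorem evictKey_cons_lt_iff {K : ℕ} {ρ : List U} {x y z : U} (hx : x ≠ z) (hy : y ≠ z) :
    evictKey K (z :: ρ) x < evictKey K (z :: ρ) y ↔ evictKey K ρ x < evictKey K ρ y := by
  simp only [evictKey_lt_iff, phiRev_cons_of_ne hx.symm, phiRev_cons_of_ne hy.symm,
    enat_add_one_lt_add_one_iff]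

theorem phiRev_restrict_lt_iff {X : Set U} {x y : U} (hx : x ∈ X) (hy : y ∈ X) (hxy : x ≠ y)
    (ρ : List U) (i j : ℕ) :
    phiRev x i (restrict ρ X) < phiRev y j (restrict ρ X) ↔
      phiRev x i ρ < phiRev y j ρ := by
  induction ρ generalizing i j with
  | nil => rfl
  | cons h ρ ih =>
    by_cases hX : h ∈ X
    · have hr : restrict (h :: ρ) X = h :: restrict ρ X := by simp [restrict, hX]
      rw [hr]
      by_cases h1 : h = x
      · subst h1
        rw [phiRev_cons_of_ne hxy, phiRev_cons_of_ne hxy]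
        by_cases hi : i ≤ 1
        · simp [phiRev, hi]
        · simp only [phiRev, hi, if_true, if_false, enat_add_one_lt_add_one_iff, ih]
      · rw [phiRev_cons_of_ne h1, phiRev_cons_of_ne h1]
        by_cases h2 : h = y
        · subst h2
          by_cases hj : j ≤ 1
          · simp [phiRev, hj]
          · simp only [phiRev, hj, if_true, if_false, enat_add_one_lt_add_one_iff, ih]
        · rw [phiRev_cons_of_ne h2, phiRev_cons_of_ne h2]
          simp only [enat_add_one_lt_add_one_iff, ih]
    · have hr : restrict (h :: ρ) X = restrict ρ X := by simp [restrict, hX]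
      rw [hr, phiRev_cons_of_ne (ne_of_mem_of_not_mem hx hX).symm,
        phiRev_cons_of_ne (ne_of_mem_of_not_mem hy hX).symm,
        enat_add_one_lt_add_one_iff, ih]

theorem evictKey_restrict_lt_iff {K : ℕ} {X : Set U} {x y : U} (hx : x ∈ X) (hy : y ∈ X)
    (ρ : List U) :
    evictKey K (restrict ρ X) x < evictKey K (restrict ρ X) y ↔
      evictKey K ρ x < evictKey K ρ y := by
  rcases eq_or_ne x y with rfl | hxy
  · simp
  · simp only [evictKey_lt_iff, phiRev_restrict_lt_iff hx hy hxy,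
      phiRev_restrict_lt_iff hy hx hxy.symm]

theorem mem_restrict {V : Type*} {ρ : List V} {X : Set V} {x : V} :
    x ∈ restrict ρ X ↔ x ∈ ρ ∧ x ∈ X := by
  simp [restrict]

theorem restrict_reverse {V : Type*} (τ : List V) (X : Set V) :
    (restrict τ X).reverse = restrict τ.reverse X := by
  simp [restrict]

/-- The possible effects of a request `z` on the LRU-K cache: a hit, a miss with free space,
a miss with an eviction, and a miss in a cache of size `0`. -/
theorem LRUKrev_cons_cases (K k : ℕ) (ρ : List U) (z : U) :
    (z ∈ LRUKrev K k ρ ∧ LRUKrev K k (z :: ρ) = LRUKrev K k ρ) ∨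
    (z ∉ LRUKrev K k ρ ∧ (LRUKrev K k ρ).card < k ∧
      LRUKrev K k (z :: ρ) = insert z (LRUKrev K k ρ)) ∨
    (z ∉ LRUKrev K k ρ ∧ k ≤ (LRUKrev K k ρ).card ∧ ∃ v ∈ LRUKrev K k ρ,
      (∀ p ∈ LRUKrev K k ρ, p ≠ v → evictKey K ρ p < evictKey K ρ v) ∧
      LRUKrev K k (z :: ρ) = insert z (LRUKrev K k ρ) \ {v}) ∨
    (k ≤ (LRUKrev K k ρ).card ∧ LRUKrev K k ρ = ∅ ∧ LRUKrev K k (z :: ρ) = ∅) := by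
  by_cases hz : z ∈ LRUKrev K k ρ
  · left
    simp [LRUKrev, hz]
  by_cases hk : (LRUKrev K k ρ).card < k
  · right; left
    simp [LRUKrev, hz, hk]
  by_cases hC : (LRUKrev K k ρ).Nonempty
  · right; right; left
    obtain ⟨v, hv, hmax⟩ := Finset.exists_mem_eq_sup' hC (evictKey K (z :: ρ))
    refine ⟨hz, not_lt.1 hk, v, hv, fun p hp hpv => ?_, ?_⟩
    · rw [← evictKey_cons_lt_iff (z := z) (fun e => hz (e ▸ hp)) (fun e => hz (e ▸ hv))]
      refine lt_of_le_of_ne ?_ fun e => hpv (evictKey_injective _ _ e)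
      exact hmax ▸ Finset.le_sup' _ hp
    · have hv' : (ofLex ((LRUKrev K k ρ).sup' hC
          fun y => toLex (phiRev y K (z :: ρ), y))).2 = v :=
        congrArg (fun p => (ofLex p).2) hmax
      rw [LRUKrev]
      simp only [hz, hk, hC, if_false, dif_pos, hv']
  · right; right; right
    have h0 := Finset.not_nonempty_iff_eq_empty.1 hC
    refine ⟨not_lt.1 hk, h0, ?_⟩
    rw [LRUKrev]
    simp only [hz, hk, hC, if_false, dif_neg, not_false_eq_true]
    exact h0

theorem mem_of_mem_LRUKrev {K k : ℕ} {ρ : List U} {x : U} (hx : x ∈ LRUKrev K k ρ) :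
    x ∈ ρ := by
  induction ρ with
  | nil => simp [LRUKrev] at hx
  | cons z ρ ih =>
    rcases LRUKrev_cons_cases K k ρ z with ⟨_, h⟩ | ⟨_, _, h⟩ | ⟨_, _, v, _, _, h⟩ | ⟨_, _, h⟩ <;>
      rw [h] at hx <;> simp at hx ⊢ <;> tauto

/-- As long as the cache has free space, it holds every item requested so far. -/
theorem mem_LRUKrev_of_card_lt {K k : ℕ} {ρ : List U} (hk : (LRUKrev K k ρ).card < k) {x : U}
    (hx : x ∈ ρ) : x ∈ LRUKrev K k ρ := by
  induction ρ with
  | nil => simp at hx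
  | cons z ρ ih =>
    rcases LRUKrev_cons_cases K k ρ z with
      ⟨hz, h⟩ | ⟨_, hlt, h⟩ | ⟨hz, hle, v, hv, _, h⟩ | ⟨hle, h0, h⟩ <;> rw [h] at hk ⊢
    · rcases List.mem_cons.1 hx with rfl | hx
      · exact hz
      · exact ih hk hx
    · rcases List.mem_cons.1 hx with rfl | hx
      · exact Finset.mem_insert_self _ _
      · exact Finset.mem_insert_of_mem (ih hlt hx)
    · rw [Finset.card_sdiff_of_subset (by simp [hv]), Finset.card_insert_of_notMem hz,
        Finset.card_singleton] at hk
      omega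
    · rw [h0] at hle
      omega

/-- With one possible exception, every cached item ranks below every requested item that is
not cached. -/
theorem exists_forall_evictKey_lt [Nonempty U] (K k : ℕ) (ρ : List U) :
    ∃ w, ∀ p ∈ LRUKrev K k ρ, p ≠ w → ∀ q ∈ ρ, q ∉ LRUKrev K k ρ →
      evictKey K ρ p < evictKey K ρ q := by
  induction ρ with
  | nil => simp [LRUKrev]
  | cons z ρ ih =>
    obtain ⟨w, hw⟩ := ih
    rcases LRUKrev_cons_cases K k ρ z with
      ⟨hz, h⟩ | ⟨_, hlt, h⟩ | ⟨hz, hle, v, hv, hmax, h⟩ | ⟨_, _, h⟩ <;> rw [h]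
    · refine ⟨w, fun p hp hpw q hq hqC => ?_⟩
      have hqz : q ≠ z := fun e => hqC (e ▸ hz)
      exact evictKey_cons_lt hqz (hw p hp hpw q ((List.mem_cons.1 hq).resolve_left hqz) hqC)
    · refine ⟨z, fun p _ _ q hq hqC => absurd ?_ hqC⟩
      rcases List.mem_cons.1 hq with rfl | hq
      · exact Finset.mem_insert_self _ _
      · exact Finset.mem_insert_of_mem (mem_LRUKrev_of_card_lt hlt hq)
    · have hvz : v ≠ z := fun e => hz (e ▸ hv)
      refine ⟨z, fun p hp hpz q hq hqC => ?_⟩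
      simp only [Finset.mem_sdiff, Finset.mem_insert, Finset.mem_singleton] at hp hqC
      have hpC : p ∈ LRUKrev K k ρ := hp.1.resolve_left hpz
      have hqz : q ≠ z := by rintro rfl; exact hqC ⟨Or.inl rfl, hvz.symm⟩
      apply evictKey_cons_lt hqz
      by_cases hqv : q = v
      · exact hqv ▸ hmax p hpC hp.2
      · have hqC' : q ∉ LRUKrev K k ρ := fun hq => hqC ⟨Or.inr hq, hqv⟩
        have hqρ := (List.mem_cons.1 hq).resolve_left hqz
        by_cases hpw : p = w
        · exact (hmax p hpC hp.2).trans (hw v hv (fun e => hp.2 (hpw.trans e.symm)) q hqρ hqC')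
        · exact hw p hpC hpw q hqρ hqC'
    · exact ⟨z, by simp⟩

/-- **LRU-K is stable** (for every `K ≥ 1`). -/
theorem lruK_isStable (K : ℕ) (hK : 1 ≤ K) :
    ∀ (τ : List U) (X : Set U) (z : U), z ∈ X →
      ∀ a b : ℕ, b < a →
        (Out (LRUK (U := U) K) b (restrict τ X) z ∩ LRUK K a (τ ++ [z])).Nonempty →
        LRUK K b (restrict τ X ++ [z]) ⊆ LRUK K a (τ ++ [z]) := by
  intro τ X z hzX a b _ hne
  have : Nonempty U := ⟨z⟩
  obtain ⟨y, hy⟩ := hne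
  simp only [Out, LRUK, Finset.mem_inter, Finset.mem_sdiff, List.reverse_append,
    List.reverse_singleton, List.singleton_append, restrict_reverse] at hy ⊢
  generalize τ.reverse = ρ at hy ⊢
  obtain ⟨⟨hyB, hyB'⟩, hyA'⟩ := hy
  rcases LRUKrev_cons_cases K b (restrict ρ X) z with
    ⟨_, h⟩ | ⟨_, _, h⟩ | ⟨hzB, _, v, hvB, hmax, h⟩ | ⟨_, h0, _⟩
  · exact absurd (h ▸ hyB) hyB'
  · exact absurd (h ▸ Finset.mem_insert_of_mem hyB) hyB'
  · obtain rfl : y = v := by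
      by_contra hyv
      exact hyB' (h ▸ by simp [hyB, hyv])
    have hyz : y ≠ z := fun e => hzB (e ▸ hyB)
    have hyX := (mem_restrict.1 (mem_of_mem_LRUKrev hyB)).2
    intro x hx
    rw [h] at hx
    simp only [Finset.mem_sdiff, Finset.mem_insert, Finset.mem_singleton] at hx
    obtain ⟨hx, hxy⟩ := hx
    by_contra hxA'
    obtain ⟨wA, hwA⟩ := exists_forall_evictKey_lt K a ρ
    obtain ⟨wB, hwB⟩ := exists_forall_evictKey_lt K b (restrict ρ X)
    rcases LRUKrev_cons_cases K a ρ z with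
      ⟨hzA, hA⟩ | ⟨_, hlt, hA⟩ | ⟨hzA, _, u, huA, humax, hA⟩ | ⟨_, _, hA⟩ <;>
      rw [hA] at hyA' hxA'
    · have hxz : x ≠ z := fun e => hxA' (e ▸ hzA)
      have hxB := hx.resolve_left hxz
      obtain ⟨hxρ, hxX⟩ := mem_restrict.1 (mem_of_mem_LRUKrev hxB)
      have hxy' := (evictKey_restrict_lt_iff hxX hyX ρ).1 (hmax x hxB hxy)
      by_cases hyw : y = wA
      · have hzx := hwA z hzA (fun e => hyz (hyw.trans e.symm)) x hxρ hxA'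
        have hzρ := mem_restrict.2 ⟨mem_of_mem_LRUKrev hzA, hzX⟩
        by_cases hxw : x = wB
        · have hyz' := (evictKey_restrict_lt_iff hyX hzX ρ).1
            (hwB y hyB (fun e => hxy (hxw.trans e.symm)) z hzρ hzB)
          exact lt_asymm (hyz'.trans hzx) hxy'
        · exact lt_asymm hzx ((evictKey_restrict_lt_iff hxX hzX ρ).1 (hwB x hxB hxw z hzρ hzB))
      · exact lt_asymm hxy' (hwA y hyA' hyw x hxρ hxA')
    · simp only [Finset.mem_insert, not_or] at hxA'
      exact hxA'.2 (mem_LRUKrev_of_card_lt hlt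
        (mem_restrict.1 (mem_of_mem_LRUKrev (hx.resolve_left hxA'.1))).1)
    · have huz : u ≠ z := fun e => hzA (e ▸ huA)
      simp only [Finset.mem_sdiff, Finset.mem_insert, Finset.mem_singleton] at hyA' hxA'
      have hxz : x ≠ z := by rintro rfl; exact hxA' ⟨Or.inl rfl, huz.symm⟩
      have hxB := hx.resolve_left hxz
      obtain ⟨hxρ, hxX⟩ := mem_restrict.1 (mem_of_mem_LRUKrev hxB)
      have hxy' := (evictKey_restrict_lt_iff hxX hyX ρ).1 (hmax x hxB hxy)
      have hyu := humax y (hyA'.1.resolve_left hyz) hyA'.2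
      by_cases hxu : x = u
      · exact lt_asymm hxy' (hxu ▸ hyu)
      · have hxA : x ∉ LRUKrev K a ρ := fun hxA => hxA' ⟨Or.inr hxA, hxu⟩
        by_cases hyw : y = wA
        · exact lt_asymm (hxy'.trans hyu)
            (hwA u huA (fun e => hyA'.2 (hyw.trans e.symm)) x hxρ hxA)
        · exact lt_asymm hxy' (hwA y (hyA'.1.resolve_left hyz) hyw x hxρ hxA)
    · simp at hyA'
  · simp [h0] at hyB

end SetAssoc
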